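/- For every real ε with 0 < ε ≤ 1/8, the sets U₁ and U₂ are disjoint: U₁ ∩ U₂ = ∅. -/

import Mathlib

open Matrix

noncomputable section

/-- `ξ = exp(2πi/3)`, a primitive cube root of unity. -/
def ξ : ℂ := Complex.exp (2 * Real.pi * Complex.I / 3)

/-- The cyclic permutation matrix `A`, with rows `(0,1,0)`, `(0,0,1)`, `(1,0,0)`. -/
def A : Matrix (Fin 3) (Fin 3) ℂ := !![0, 1, 0; 0, 0, 1; 1, 0, 0]

/-- The diagonal matrix `B = diag(1, ξ, ξ²)`. -/
def B : Matrix (Fin 3) (Fin 3) ℂ := !![1, 0, 0; 0, ξ, 0; 0, 0, ξ ^ 2]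

/-- The matrix `P = (1/√3)·[[1,ξ,1],[1,1,ξ],[ξ,1,1]]`. -/
def P : Matrix (Fin 3) (Fin 3) ℂ :=
  (((Real.sqrt 3 : ℝ) : ℂ))⁻¹ • !![1, ξ, 1; 1, 1, ξ; ξ, 1, 1]

/-- Euclidean space `ℂ³`. -/
abbrev E3 := EuclideanSpace ℂ (Fin 3)

/-- Application of a `3 × 3` complex matrix to a vector in `ℂ³`. -/
def app (M : Matrix (Fin 3) (Fin 3) ℂ) (v : E3) : E3 := Matrix.toEuclideanLin M v

/-- The unit sphere `S⁵ ⊆ ℂ³`. -/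
abbrev S5 : Set E3 := Metric.sphere (0 : E3) 1

/-- The subset `U₁ = {A^k v : k ∈ ℕ, ‖v‖ = 1, |v₂|² + |v₃|² ≤ ε}` of `S⁵`. -/
def U1 (ε : ℝ) : Set S5 :=
  {w | ∃ (k : ℕ) (v : E3), ‖v‖ = 1 ∧ ‖v 1‖ ^ 2 + ‖v 2‖ ^ 2 ≤ ε ∧ (w : E3) = app (A ^ k) v}

/-- The subset `U₂ = P · U₁` of `S⁵`. -/
def U2 (ε : ℝ) : Set S5 := {w | ∃ u ∈ U1 ε, (w : E3) = app P (u : E3)}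

lemma norm_ξ : ‖ξ‖ = 1 := by
  have h : (2 * Real.pi * Complex.I / 3 : ℂ) = ((2 * Real.pi / 3 : ℝ) : ℂ) * Complex.I := by
    push_cast
    ring
  rw [ξ, h, Complex.norm_exp_ofReal_mul_I]

lemma app_apply (M : Matrix (Fin 3) (Fin 3) ℂ) (v : E3) (i : Fin 3) :
    app M v i = M i 0 * v 0 + M i 1 * v 1 + M i 2 * v 2 := by
  simp [app, Matrix.toLpLin_apply, Matrix.mulVec, dotProduct, Fin.sum_univ_three]

lemma app_mul (M N : Matrix (Fin 3) (Fin 3) ℂ) (v : E3) : app (M * N) v = app M (app N v) := by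
  simp [app, Matrix.toLpLin_apply]

/-- `A` permutes the coordinates of a vector. -/
lemma exists_coord_app_A (v : E3) (i : Fin 3) : ∃ j, app A v j = v i := by
  fin_cases i
  · exact ⟨2, by simp [app_apply, A]⟩
  · exact ⟨0, by simp [app_apply, A]⟩
  · exact ⟨1, by simp [app_apply, A]⟩

lemma exists_coord_app_A_pow (k : ℕ) (v : E3) (i : Fin 3) : ∃ j, app (A ^ k) v j = v i := by
  induction k with
  | zero => exact ⟨i, by simp [app]⟩
  | succ k ih =>
    obtain ⟨j, hj⟩ := ih
    obtain ⟨l, hl⟩ := exists_coord_app_A (app (A ^ k) v) j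
    exact ⟨l, by rw [pow_succ', app_mul, hl, hj]⟩

lemma norm_sq_eq_sum_three (v : E3) : ‖v‖ ^ 2 = ‖v 0‖ ^ 2 + ‖v 1‖ ^ 2 + ‖v 2‖ ^ 2 := by
  rw [EuclideanSpace.norm_sq_eq, Fin.sum_univ_three]

/-- Every vector in `U₁` has a dominant coordinate. -/
lemma exists_le_norm_sq_of_mem_U1 {ε : ℝ} {w : S5} (hw : w ∈ U1 ε) :
    ∃ i, 1 - ε ≤ ‖(w : E3) i‖ ^ 2 := by
  obtain ⟨k, v, hv, hvε, hwv⟩ := hw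
  obtain ⟨j, hj⟩ := exists_coord_app_A_pow k v 0
  refine ⟨j, ?_⟩
  have h := norm_sq_eq_sum_three v
  rw [hv] at h
  rw [hwv, hj]
  linarith

lemma add_add_le_of_sq {a b c : ℝ} (h : a ^ 2 + b ^ 2 + c ^ 2 = 1) (ha : 7 / 8 ≤ a ^ 2) :
    a + b + c ≤ 3 / 2 := by
  have ha1 : a ≤ 1 := by nlinarith [sq_nonneg b, sq_nonneg c]
  have hbc : b + c ≤ 1 / 2 := by nlinarith [sq_nonneg (b - c)]
  linarith

/-- A unit vector with a dominant coordinate has small `ℓ¹` norm. -/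
lemma sum_norm_le_of_le_norm_sq {v : E3} (hv : ‖v‖ = 1) {i : Fin 3}
    (hi : 7 / 8 ≤ ‖v i‖ ^ 2) : ‖v 0‖ + ‖v 1‖ + ‖v 2‖ ≤ 3 / 2 := by
  have h := norm_sq_eq_sum_three v
  rw [hv] at h
  fin_cases i
  · exact add_add_le_of_sq (by linarith) hi
  · linarith [add_add_le_of_sq (a := ‖v 1‖) (b := ‖v 0‖) (c := ‖v 2‖) (by linarith) hi]
  · linarith [add_add_le_of_sq (a := ‖v 2‖) (b := ‖v 0‖) (c := ‖v 1‖) (by linarith) hi]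

lemma norm_P_apply (i j : Fin 3) : ‖P i j‖ = (Real.sqrt 3)⁻¹ := by
  fin_cases i <;> fin_cases j <;> simp [P, norm_ξ, abs_of_nonneg (Real.sqrt_nonneg 3)]

lemma norm_app_P_le (v : E3) (i : Fin 3) :
    ‖app P v i‖ ≤ (Real.sqrt 3)⁻¹ * (‖v 0‖ + ‖v 1‖ + ‖v 2‖) := by
  rw [app_apply]
  refine norm_add₃_le.trans_eq ?_
  simp only [norm_mul, norm_P_apply]
  ring

/-- For `0 < ε ≤ 1/8` the sets `U₁` and `U₂` are disjoint. -/
theorem U1_disjoint_U2 (ε : ℝ) (hε0 : 0 < ε) (hε : ε ≤ 1 / 8) : U1 ε ∩ U2 ε = ∅ := by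
  rw [Set.eq_empty_iff_forall_notMem]
  rintro w ⟨hw, u, hu, hwu⟩
  obtain ⟨i, hi⟩ := exists_le_norm_sq_of_mem_U1 hw
  obtain ⟨j, hj⟩ := exists_le_norm_sq_of_mem_U1 hu
  have hsum := sum_norm_le_of_le_norm_sq (norm_eq_of_mem_sphere u) (i := j) (by linarith)
  have hle : ‖(w : E3) i‖ ≤ (Real.sqrt 3)⁻¹ * (3 / 2) := by
    rw [hwu]
    exact (norm_app_P_le _ i).trans (by gcongr)
  have hsq : ‖(w : E3) i‖ ^ 2 ≤ ((Real.sqrt 3)⁻¹ * (3 / 2)) ^ 2 := by gcongr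
  rw [mul_pow, inv_pow, Real.sq_sqrt (by norm_num)] at hsq
  linarith
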